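/- arXiv:0907.3770 — 2 statements merged into one kernel-verified Lean document; each statement's English description precedes it below -/
import Mathlib

section
/- One has L L⁺ = L⁺ L = I − (1/n) J, where I is the n×n identity matrix and J is the n×n matrix all of whose entries equal 1. -/
open Matrix BigOperators Finset

theorem lap_mulVec_apply {n : ℕ} (C : Fin n → Fin n → ℝ) (hCdiag : ∀ p, C p p = 0)
    (L : Matrix (Fin n) (Fin n) ℝ)
    (hL : ∀ p q, L p q = if p = q then ∑ x, C p x else -C p q)
    (v : Fin n → ℝ) (p : Fin n) : ∑ q, L p q * v q = ∑ q, C p q * (v p - v q) := by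
  have h : ∀ q, L p q * v q = (if p = q then (∑ x, C p x) * v p else 0) - C p q * v q := by
    intro q
    rw [hL]
    split_ifs with h
    · subst h; rw [hCdiag]; ring
    · ring
  simp only [h, Finset.sum_sub_distrib, mul_sub, Finset.sum_mul]
  simp

theorem lap_ker {n : ℕ} (C : Fin n → Fin n → ℝ)
    (hCsymm : ∀ p q, C p q = C q p)
    (hCnonneg : ∀ p q, 0 ≤ C p q)
    (hconn : (SimpleGraph.fromRel (fun p q : Fin n => 0 < C p q)).Connected)
    (v : Fin n → ℝ) (hv : ∀ p, ∑ q, C p q * (v p - v q) = 0) (p q : Fin n) : v p = v q := by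
  have h1 : ∑ p, ∑ q, C p q * (v p - v q) * v p = 0 := by
    simp only [← Finset.sum_mul, hv]; simp
  have h2 : ∑ p, ∑ q, C p q * (v p - v q) * v q = - 0 := by
    rw [← h1, Finset.sum_comm, ← Finset.sum_neg_distrib]
    refine Finset.sum_congr rfl fun p _ => ?_
    rw [← Finset.sum_neg_distrib]
    refine Finset.sum_congr rfl fun q _ => ?_
    rw [hCsymm q p]; ring
  have h3 : ∑ p, ∑ q, C p q * (v p - v q) ^ 2 = 0 := by
    have : ∀ p q, C p q * (v p - v q) ^ 2
        = C p q * (v p - v q) * v p - C p q * (v p - v q) * v q := fun p q => by ring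
    simp only [this, Finset.sum_sub_distrib]
    rw [h1, h2]; simp
  have hnn : ∀ p q, 0 ≤ C p q * (v p - v q) ^ 2 :=
    fun p q => mul_nonneg (hCnonneg p q) (sq_nonneg _)
  have h4 : ∀ p q, C p q * (v p - v q) ^ 2 = 0 := by
    intro p q
    have h5 := (Finset.sum_eq_zero_iff_of_nonneg
      (fun p _ => Finset.sum_nonneg fun q _ => hnn p q)).1 h3 p (Finset.mem_univ _)
    exact (Finset.sum_eq_zero_iff_of_nonneg (fun q _ => hnn p q)).1 h5 q (Finset.mem_univ _)
  have h6 : ∀ p q, 0 < C p q → v p = v q := by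
    intro p q h
    rcases mul_eq_zero.1 (h4 p q) with h' | h'
    · exact absurd h' h.ne'
    · exact sub_eq_zero.1 (pow_eq_zero_iff two_ne_zero |>.1 h')
  obtain ⟨w⟩ := hconn.preconnected p q
  induction w with
  | nil => rfl
  | cons hadj _ ih =>
    rw [SimpleGraph.fromRel_adj] at hadj
    rw [← ih]
    rcases hadj.2 with h | h
    · exact h6 _ _ h
    · exact (h6 _ _ h).symm

theorem lap_proj {n : ℕ} (L P : Matrix (Fin n) (Fin n) ℝ)
    (hker : ∀ v : Fin n → ℝ, (∀ p, ∑ q, L p q * v q = 0) → ∀ p q, v p = v q)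
    (hLP : L * P = L) (hsym : Pᵀ = P) (hone : ∀ p, ∑ q, P p q = 0) :
    P = 1 - (n : ℝ)⁻¹ • Matrix.of (fun _ _ : Fin n => (1 : ℝ)) := by
  have h0 : L * (1 - P) = 0 := by rw [mul_sub, hLP, mul_one, sub_self]
  have hcol : ∀ r p q, (1 - P) p r = (1 - P) q r := by
    intro r
    refine hker (fun p => (1 - P) p r) fun p => ?_
    have := congrFun (congrFun h0 p) r
    rwa [Matrix.mul_apply] at this
  have hs : (1 - P)ᵀ = 1 - P := by rw [Matrix.transpose_sub, hsym, Matrix.transpose_one]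
  have hrow : ∀ p q r, (1 - P) p q = (1 - P) p r := by
    intro p q r
    have h := hcol p q r
    rw [← hs]
    exact h
  ext p q
  have hn : (n : ℝ) ≠ 0 := by
    have := p.pos
    positivity
  have hsum : ∑ r, (1 - P) p r = 1 := by
    simp [Matrix.sub_apply, Finset.sum_sub_distrib, hone, Matrix.one_apply]
  rw [Finset.sum_congr rfl (fun r _ => hrow p r q)] at hsum
  simp only [Finset.sum_const, Finset.card_univ, Fintype.card_fin, nsmul_eq_mul] at hsum
  have h7 : (1 - P) p q = (n : ℝ)⁻¹ := by
    field_simp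
    linarith
  simp only [Matrix.sub_apply, Matrix.smul_apply, Matrix.of_apply, smul_eq_mul, mul_one] at h7 ⊢
  linarith

/-- `L L⁺ = L⁺ L = I - (1/n) J`. -/
theorem laplacian_pinv_mul
    (n : ℕ) (hn : 2 ≤ n)
    (C : Fin n → Fin n → ℝ)
    (hCsymm : ∀ p q, C p q = C q p)
    (hCnonneg : ∀ p q, 0 ≤ C p q)
    (hCdiag : ∀ p, C p p = 0)
    (hconn : (SimpleGraph.fromRel (fun p q : Fin n => 0 < C p q)).Connected)
    (L : Matrix (Fin n) (Fin n) ℝ)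
    (hL : ∀ p q, L p q = if p = q then ∑ x, C p x else -C p q)
    (Lplus : Matrix (Fin n) (Fin n) ℝ)
    (hLp1 : L * Lplus * L = L) (hLp2 : Lplus * L * Lplus = Lplus)
    (hLp3 : (L * Lplus)ᵀ = L * Lplus) (hLp4 : (Lplus * L)ᵀ = Lplus * L) :
    L * Lplus = 1 - (n : ℝ)⁻¹ • Matrix.of (fun _ _ : Fin n => (1 : ℝ)) ∧
    Lplus * L = 1 - (n : ℝ)⁻¹ • Matrix.of (fun _ _ : Fin n => (1 : ℝ)) := by
  have hap := lap_mulVec_apply C hCdiag L hL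
  have hker : ∀ v : Fin n → ℝ, (∀ p, ∑ q, L p q * v q = 0) → ∀ p q, v p = v q :=
    fun v hv => lap_ker C hCsymm hCnonneg hconn v fun p => by rw [← hap]; exact hv p
  have hLone : ∀ p, ∑ q, L p q = 0 := fun p => by simpa using hap (fun _ => 1) p
  have hLT : Lᵀ = L := by
    ext p q
    rw [Matrix.transpose_apply, hL, hL]
    by_cases h : p = q
    · subst h; rfl
    · rw [if_neg h, if_neg (Ne.symm h), hCsymm]
  have hM : ∀ (M : Matrix (Fin n) (Fin n) ℝ) p, ∑ q, (M * L) p q = 0 := by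
    intro M p
    simp only [Matrix.mul_apply]
    rw [Finset.sum_comm]
    simp [← Finset.mul_sum, hLone]
  constructor
  · refine lap_proj L _ hker ?_ hLp3 ?_
    · have h := congrArg Matrix.transpose hLp1
      rwa [Matrix.transpose_mul, hLp3, hLT] at h
    · rw [← hLp3, Matrix.transpose_mul, hLT]
      exact hM _
  · refine lap_proj L _ hker ?_ hLp4 (hM _)
    rw [← Matrix.mul_assoc, hLp1]
end

section
/- For every integer k ≥ 1, ∑_{i ∈ V} ∑_{t ∈ V} C_i · l⁺_{it} · p^{(k)}_{it} = k − n − ∑_{m=1}^{k−1} tr(P^m) + ∑_{i ∈ V} C_i · l⁺_{ii}. -/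
open Matrix BigOperators Finset

lemma ker_const {n : ℕ} (C : Fin n → Fin n → ℝ)
    (hCsymm : ∀ p q, C p q = C q p)
    (hCnonneg : ∀ p q, 0 ≤ C p q)
    (hconn : (SimpleGraph.fromRel (fun p q : Fin n => 0 < C p q)).Connected)
    (v : Fin n → ℝ) (hv : ∀ p, ∑ q, C p q * (v p - v q) = 0) (a b : Fin n) : v a = v b := by
  have h0 : ∑ p, ∑ q, C p q * (v p - v q) ^ 2 = 0 := by
    have h1 : ∑ p, ∑ q, v p * (C p q * (v p - v q)) = 0 := by
      simp [← Finset.mul_sum, hv]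
    have h2 : ∑ p, ∑ q, v q * (C p q * (v q - v p)) = 0 := by
      rw [Finset.sum_comm, ← h1]
      refine Finset.sum_congr rfl fun p _ => Finset.sum_congr rfl fun q _ => ?_
      rw [hCsymm q p]
    have h3 := congrArg₂ (· + ·) h1 h2
    simp only [← Finset.sum_add_distrib, add_zero] at h3
    rw [← h3]
    refine Finset.sum_congr rfl fun p _ => Finset.sum_congr rfl fun q _ => ?_
    ring
  have hnn : ∀ p q, 0 ≤ C p q * (v p - v q) ^ 2 := fun p q =>
    mul_nonneg (hCnonneg p q) (sq_nonneg _)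
  have key : ∀ p q, C p q * (v p - v q) ^ 2 = 0 := by
    intro p q
    have h1 := (Finset.sum_eq_zero_iff_of_nonneg
      (fun p _ => Finset.sum_nonneg (fun q _ => hnn p q))).1 h0 p (Finset.mem_univ _)
    exact (Finset.sum_eq_zero_iff_of_nonneg (fun q _ => hnn p q)).1 h1 q (Finset.mem_univ _)
  have hpos : ∀ p q, 0 < C p q → v p = v q := by
    intro p q h
    have h1 := key p q
    have h2 : (v p - v q) ^ 2 = 0 := by
      rcases mul_eq_zero.1 h1 with h | h
      · linarith
      · exact h
    have := pow_eq_zero_iff (two_ne_zero) |>.1 h2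
    linarith
  obtain ⟨w⟩ := hconn.preconnected a b
  induction w with
  | nil => rfl
  | cons h _ ih =>
    rw [← ih]
    rw [SimpleGraph.fromRel_adj] at h
    rcases h.2 with h | h
    · exact hpos _ _ h
    · exact (hpos _ _ h).symm

theorem trans_matrix_closed_form
    (n : ℕ) (hn : 2 ≤ n)
    (C : Fin n → Fin n → ℝ)
    (hCsymm : ∀ p q, C p q = C q p)
    (hCnonneg : ∀ p q, 0 ≤ C p q)
    (hCdiag : ∀ p, C p p = 0)
    (hconn : (SimpleGraph.fromRel (fun p q : Fin n => 0 < C p q)).Connected)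
    (L : Matrix (Fin n) (Fin n) ℝ)
    (hL : ∀ p q, L p q = if p = q then ∑ x, C p x else -C p q)
    (Lplus : Matrix (Fin n) (Fin n) ℝ)
    (hLp1 : L * Lplus * L = L) (hLp2 : Lplus * L * Lplus = Lplus)
    (hLp3 : (L * Lplus)ᵀ = L * Lplus) (hLp4 : (Lplus * L)ᵀ = Lplus * L)
    (P : Matrix (Fin n) (Fin n) ℝ)
    (hP : ∀ p q, P p q = C p q / (∑ x, C p x))
    (k : ℕ) (hk : 1 ≤ k) :
    ∑ i, ∑ t, (∑ x, C i x) * Lplus i t * (P ^ k) i t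
      = (k : ℝ) - (n : ℝ) - (∑ m ∈ Finset.Icc 1 (k - 1), (P ^ m).trace)
          + ∑ i, (∑ x, C i x) * Lplus i i := by
  have hLv : ∀ (v : Fin n → ℝ) p, (L *ᵥ v) p = ∑ q, C p q * (v p - v q) := by
    intro v p
    have h1 : ∀ q, L p q * v q = (if p = q then (∑ x, C p x) * v q else 0) - C p q * v q := by
      intro q
      rw [hL]
      split_ifs with h
      · subst h; rw [hCdiag]; ring
      · ring
    simp only [Matrix.mulVec, dotProduct, h1, Finset.sum_sub_distrib, mul_sub,
      Finset.sum_ite_eq, Finset.mem_univ, if_true, Finset.sum_mul]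
  have hker : ∀ v : Fin n → ℝ, L *ᵥ v = 0 → ∀ a b, v a = v b := by
    intro v hv
    apply ker_const C hCsymm hCnonneg hconn v
    intro p
    rw [← hLv, hv]; rfl
  have hC0 : ∀ i, (∑ x, C i x) ≠ 0 := by
    intro i hi
    haveI : Nontrivial (Fin n) := Fin.nontrivial_iff_two_le.2 hn
    obtain ⟨j, hj⟩ := exists_ne i
    have hz : ∀ x, C i x = 0 := fun x =>
      (Finset.sum_eq_zero_iff_of_nonneg (fun q _ => hCnonneg i q)).1 hi x (Finset.mem_univ _)
    have := ker_const C hCsymm hCnonneg hconn (fun x => if x = i then 1 else 0) (by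
      intro p
      refine Finset.sum_eq_zero fun q _ => ?_
      by_cases hp : p = i
      · subst hp; rw [hz]; ring
      · by_cases hq : q = i
        · subst hq; rw [hCsymm, hz]; ring
        · simp [hp, hq]) i j
    simp [hj] at this
  have hL1 : L *ᵥ (fun _ => 1) = 0 := by
    funext p
    rw [hLv]; simp
  -- the projector
  obtain ⟨M, hM⟩ : ∃ M, M = 1 - Lplus * L := ⟨_, rfl⟩
  have hLM : L * M = 0 := by
    rw [hM, mul_sub, mul_one, ← mul_assoc, hLp1, sub_self]
  have hMT : ∀ i j, M i j = M j i := by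
    intro i j
    have : Mᵀ = M := by rw [hM, transpose_sub, hLp4, transpose_one]
    exact (congrFun (congrFun this i) j).symm
  have hMc : ∀ i j j', M i j = M i j' := by
    intro i j j'
    rw [hMT i j, hMT i j']
    refine hker (fun x => M x i) ?_ j j'
    funext p
    exact congrFun (congrFun hLM p) i
  have hM1 : ∀ i, ∑ j, M i j = 1 := by
    intro i
    have : M *ᵥ (fun _ => (1:ℝ)) = fun _ => 1 := by
      rw [hM, sub_mulVec, ← mulVec_mulVec, hL1]; simp
    have := congrFun this i
    simpa [Matrix.mulVec, dotProduct] using this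
  have hP1 : ∀ k, (P ^ k) *ᵥ (fun _ => (1:ℝ)) = fun _ => 1 := by
    intro k
    induction k with
    | zero => simp
    | succ k ih =>
      rw [pow_succ, ← mulVec_mulVec]
      have : P *ᵥ (fun _ => (1:ℝ)) = fun _ => 1 := by
        funext i
        simp only [Matrix.mulVec, dotProduct, hP, mul_one, ← Finset.sum_div]
        exact div_self (hC0 i)
      rw [this, ih]
  have hMP : ∀ k, (M * P ^ k).trace = 1 := by
    intro k
    rw [Matrix.trace_mul_comm]
    simp only [Matrix.trace, Matrix.diag, Matrix.mul_apply]
    obtain ⟨i₀⟩ : Nonempty (Fin n) := ⟨⟨0, by omega⟩⟩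
    rw [← hM1 i₀]
    refine Finset.sum_congr rfl fun i _ => ?_
    have h1 := congrFun (hP1 k) i
    simp only [Matrix.mulVec, dotProduct, mul_one] at h1
    have h2 : ∀ j, M j i = M i₀ i := by
      intro j
      rw [hMT j i, hMc i j i₀, hMT i i₀]
    simp only [h2, ← Finset.sum_mul, h1, one_mul]
  obtain ⟨D, hD⟩ : ∃ D : Matrix (Fin n) (Fin n) ℝ, D = Matrix.diagonal (fun i => ∑ x, C i x) :=
    ⟨_, rfl⟩
  have hDP : D * P = Matrix.of C := by
    ext i j
    rw [hD, Matrix.diagonal_mul, hP, mul_div_cancel₀ _ (hC0 i)]; rfl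
  have hDL : D * P = D - L := by
    rw [hDP]
    ext i j
    rw [Matrix.sub_apply, hD, hL, Matrix.diagonal_apply, Matrix.of_apply]
    split_ifs with h
    · subst h; rw [hCdiag]; ring
    · ring
  have hDT : Dᵀ = D := by rw [hD, Matrix.diagonal_transpose]
  have hsemi : SemiconjBy D P Pᵀ := by
    change D * P = Pᵀ * D
    have : (D * P)ᵀ = D * P := by
      rw [hDP]; ext i j; exact hCsymm j i
    rw [← this, transpose_mul, hDT]
  have hsym : ∀ k, (D * P ^ k)ᵀ = D * P ^ k := by
    intro k
    rw [transpose_mul, hDT, transpose_pow]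
    exact (hsemi.pow_right k).symm
  have hS : ∀ k, ∑ i, ∑ t, (∑ x, C i x) * Lplus i t * (P ^ k) i t
      = (Lplus * (D * P ^ k)).trace := by
    intro k
    simp only [Matrix.trace, Matrix.diag]
    refine Finset.sum_congr rfl fun i _ => ?_
    rw [Matrix.mul_apply]
    refine Finset.sum_congr rfl fun t _ => ?_
    have h1 : (D * P ^ k) t i = (D * P ^ k) i t := congrFun (congrFun (hsym k) i) t
    rw [h1, hD, Matrix.diagonal_mul]; ring
  have hstep : ∀ k, (Lplus * (D * P ^ (k + 1))).trace
      = (Lplus * (D * P ^ k)).trace - (P ^ k).trace + 1 := by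
    intro k
    have hLL : Lplus * L = 1 - M := by rw [hM]; abel
    rw [pow_succ', ← mul_assoc D, hDL, sub_mul, mul_sub, ← mul_assoc Lplus L, hLL, sub_mul,
      one_mul, Matrix.trace_sub, Matrix.trace_sub, hMP]
    ring
  have hzero : (Lplus * (D * P ^ 0)).trace = ∑ i, (∑ x, C i x) * Lplus i i := by
    rw [← hS]
    simp [Matrix.one_apply]
  rw [hS, ← hzero]
  induction k, hk using Nat.le_induction with
  | base =>
    rw [show (1:ℕ) = 0 + 1 from rfl, hstep 0]
    simp
    ring
  | succ k hk ih =>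
    rw [hstep k, ih, Nat.add_sub_cancel]
    obtain ⟨m, rfl⟩ : ∃ m, k = m + 1 := ⟨k - 1, by omega⟩
    rw [Finset.sum_Icc_succ_top (by omega), Nat.add_sub_cancel]
    push_cast
    ring
end
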